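/- Let G be a finitely generated group splitting over a finitely generated subgroup C that is quasi-isometrically embedded in G and has polynomial growth of degree d > 0. Then any Cayley graph Γ of G with respect to a finite generating set has the polynomial retaining property of degree d−1: there is K > 0 such that every finite initial fire of reach one admits a retaining {K·n^{d−1}}-strategy. -/

import Mathlib

/-- The growth comparison relation: `f ≼ g` iff there is `C > 0` with
`f n ≤ C * g (C*n + C) + C` for all `n`. -/
def GrowthLE (f g : ℕ → ℕ) : Prop :=
  ∃ C : ℕ, 0 < C ∧ ∀ n, f n ≤ C * g (C * n + C) + C

/-- Equivalence of growth rates. -/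
def GrowthEquiv (f g : ℕ → ℕ) : Prop := GrowthLE f g ∧ GrowthLE g f

/-- The growth function of a subset `U` of a metric space, with basepoint set `A`:
`n ↦ #(U ∩ B(A, n))`. -/
noncomputable def relGrowth {X : Type*} [MetricSpace X] (U A : Set X) : ℕ → ℕ :=
  fun n => Set.ncard {x | x ∈ U ∧ ∃ a ∈ A, dist a x ≤ (n : ℝ)}

/-- A metric space is discrete and proper iff all balls (of integer radius) are finite. -/
def DiscreteProper (X : Type*) [MetricSpace X] : Prop :=
  ∀ (x : X) (n : ℕ), {y : X | dist x y ≤ (n : ℝ)}.Finite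

/-- Uniformly proper: there is a uniform bound on cardinalities of all balls of radius `n`. -/
def UniformlyProper (X : Type*) [MetricSpace X] : Prop :=
  ∃ g : ℕ → ℕ, ∀ (x : X) (n : ℕ),
    {y : X | dist x y ≤ (n : ℝ)}.Finite ∧ Set.ncard {y : X | dist x y ≤ (n : ℝ)} ≤ g n

/-- A `c`-quasi-isometry between metric spaces. -/
def IsQuasiIsometryMS {X Y : Type*} [MetricSpace X] [MetricSpace Y] (c : ℝ) (φ : X → Y) : Prop :=
  1 ≤ c ∧
  (∀ a b : X, dist a b / c - c ≤ dist (φ a) (φ b) ∧ dist (φ a) (φ b) ≤ c * dist a b + c) ∧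
  (∀ y : Y, ∃ x : X, dist (φ x) y ≤ c)

/-- Growth function of `U ⊆ V(G)` (with the metric induced by the path-metric of `G`)
with respect to basepoint set `A`. -/
noncomputable def graphGrowth {V : Type*} (G : SimpleGraph V) (U A : Set V) : ℕ → ℕ :=
  fun n => Set.ncard {v | v ∈ U ∧ ∃ a ∈ A, G.dist a v ≤ n}

/-- `Growth(U) = Growth(G)` for `U` a set of vertices of `G` with the induced metric. -/
def GrowthEqFull {V : Type*} (G : SimpleGraph V) (U : Set V) : Prop :=
  ∃ u₀ ∈ U, GrowthEquiv (graphGrowth G Set.univ {u₀}) (graphGrowth G U {u₀})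

/-- The set of vertices protected up to (and including) time `n`. -/
def protectedUpTo {V : Type*} (W : ℕ → Set V) (n : ℕ) : Set V :=
  ⋃ i ∈ Finset.Icc 1 n, W i

/-- The set of vertices on fire at time `n`, for fire reach `r`, strategy `W` and
initial fire `X0`: `X (n+1)` consists of vertices joined to `X n` by a path of length
at most `r` avoiding `(W 1 ∪ ⋯ ∪ W (n+1)) \ X n`. -/
def fireSet {V : Type*} (G : SimpleGraph V) (r : ℕ) (W : ℕ → Set V) (X0 : Set V) : ℕ → Set V
  | 0 => X0
  | n + 1 =>
    {v | ∃ u ∈ fireSet G r W X0 n, ∃ p : G.Walk u v, p.length ≤ r ∧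
      ∀ x ∈ p.support, x ∉ protectedUpTo W (n + 1) \ fireSet G r W X0 n}

/-- The set of vertices on fire at the end of the game. -/
def burnedSet {V : Type*} (G : SimpleGraph V) (r : ℕ) (W : ℕ → Set V) (X0 : Set V) : Set V :=
  ⋃ n, fireSet G r W X0 n

/-- An `{f n}`-strategy: at each time `n ≥ 1` at most `f n` vertices are protected. -/
def IsStrategyBound {V : Type*} (f : ℕ → ℕ) (W : ℕ → Set V) : Prop :=
  ∀ n, 1 ≤ n → (W n).Finite ∧ (W n).ncard ≤ f n

/-- A finite-step strategy protects no vertices after some finite time. -/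
def FiniteStepStrategy {V : Type*} (W : ℕ → Set V) : Prop :=
  ∃ N, ∀ n, N ≤ n → W n = ∅

/-- A retaining `({f n}, r)`-strategy for the initial fire `X0`. -/
def IsRetainingStrategy {V : Type*} (G : SimpleGraph V) (f : ℕ → ℕ) (r : ℕ)
    (X0 : Set V) (W : ℕ → Set V) : Prop :=
  IsStrategyBound f W ∧ GrowthEqFull G (burnedSet G r W X0)ᶜ

/-- The `({f n}, r)`-retaining property. -/
def RetainingProperty {V : Type*} (G : SimpleGraph V) (f : ℕ → ℕ) (r : ℕ) : Prop :=
  ∀ X0 : Set V, X0.Finite → ∃ W, IsRetainingStrategy G f r X0 W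

/-- Polynomial retaining property of degree `d` (fire reach one). -/
def PolyRetaining {V : Type*} (G : SimpleGraph V) (d : ℕ) : Prop :=
  ∃ K : ℕ, 0 < K ∧ RetainingProperty G (fun n => K * n ^ d) 1

/-- The finite-step `{f n}`-retaining property (fire reach one). -/
def FiniteStepRetainingProperty {V : Type*} (G : SimpleGraph V) (f : ℕ → ℕ) : Prop :=
  ∀ X0 : Set V, X0.Finite → ∃ W, IsRetainingStrategy G f 1 X0 W ∧ FiniteStepStrategy W

/-- The finite-step polynomial retaining property of degree `d`. -/
def FiniteStepPolyRetaining {V : Type*} (G : SimpleGraph V) (d : ℕ) : Prop :=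
  ∃ K : ℕ, 0 < K ∧ FiniteStepRetainingProperty G (fun n => K * n ^ d)

/-- The `({f n}, r)`-containment property. -/
def ContainmentProperty {V : Type*} (G : SimpleGraph V) (f : ℕ → ℕ) (r : ℕ) : Prop :=
  ∀ X0 : Set V, X0.Finite →
    ∃ W, IsStrategyBound f W ∧ (burnedSet G r W X0).Finite

/-- Polynomial containment property of degree `d` (fire reach one). -/
def PolyContainment {V : Type*} (G : SimpleGraph V) (d : ℕ) : Prop :=
  ∃ K : ℕ, 0 < K ∧ ContainmentProperty G (fun n => K * n ^ d) 1

/-- The constant containment property. -/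
def ConstantContainment {V : Type*} (G : SimpleGraph V) : Prop := PolyContainment G 0

/-- `D` is (the vertex set of) a connected component of `G \ K`. -/
def ComponentAvoiding {V : Type*} (G : SimpleGraph V) (K D : Set V) : Prop :=
  D.Nonempty ∧ D ⊆ Kᶜ ∧
  (∀ u ∈ D, ∀ v ∈ D, ∃ p : G.Walk u v, ∀ x ∈ p.support, x ∉ K) ∧
  (∀ u ∈ D, ∀ v : V, v ∉ K → (∃ p : G.Walk u v, ∀ x ∈ p.support, x ∉ K) → v ∈ D)

/-- A deep component of `G \ K`: not contained in any bounded neighborhood of `K`. -/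
def IsDeepComponent {V : Type*} (G : SimpleGraph V) (K D : Set V) : Prop :=
  ComponentAvoiding G K D ∧ ∀ r : ℕ, ¬ D ⊆ {v | ∃ k ∈ K, G.dist k v ≤ r}

/-- An unbounded component of `G \ K`. -/
def IsUnboundedComponent {V : Type*} (G : SimpleGraph V) (K D : Set V) : Prop :=
  ComponentAvoiding G K D ∧ ∀ (v : V) (r : ℕ), ¬ D ⊆ {u | G.dist v u ≤ r}

/-- Uniformly locally finite graph: vertex degrees are bounded. -/
def UnifLocFinite {V : Type*} (G : SimpleGraph V) : Prop :=
  ∃ M : ℕ, ∀ v : V, (G.neighborSet v).Finite ∧ (G.neighborSet v).ncard ≤ M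

/-- Locally finite graph. -/
def LocFinite {V : Type*} (G : SimpleGraph V) : Prop := ∀ v : V, (G.neighborSet v).Finite

/-- A `c`-quasi-isometry between two connected graphs (with their path-metrics). -/
def GraphQI {V V' : Type*} (c : ℝ) (G : SimpleGraph V) (H : SimpleGraph V') (φ : V → V') : Prop :=
  1 ≤ c ∧
  (∀ a b : V, (G.dist a b : ℝ) / c - c ≤ (H.dist (φ a) (φ b) : ℝ) ∧
    (H.dist (φ a) (φ b) : ℝ) ≤ c * (G.dist a b : ℝ) + c) ∧
  (∀ y : V', ∃ x : V, (H.dist (φ x) y : ℝ) ≤ c)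

/-- The Cayley graph of a group with respect to a set `S`. -/
def cayley (G : Type) [Group G] (S : Set G) : SimpleGraph G :=
  SimpleGraph.fromRel (fun a b => a⁻¹ * b ∈ S)

/-- `S` is a finite generating set. -/
def IsFiniteGenSet {G : Type} [Group G] (S : Set G) : Prop :=
  S.Finite ∧ Subgroup.closure S = ⊤

/-- The ball of radius `n` around the identity for the word metric w.r.t. `T`. -/
def wordBall {G : Type} [Group G] (T : Set G) (n : ℕ) : Set G :=
  {g | ∃ l : List G, (∀ x ∈ l, x ∈ T ∨ x⁻¹ ∈ T) ∧ l.length ≤ n ∧ l.prod = g}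

/-- The word metric w.r.t. `T`. -/
noncomputable def wordDist {G : Type} [Group G] (T : Set G) (x y : G) : ℕ :=
  sInf {n | x⁻¹ * y ∈ wordBall T n}

/-- `G` is an amalgamated product `A ∗_C B` with `C` a proper subgroup of both factors,
where `C` corresponds to the given subgroup. -/
def SplitsOverAmalgam (G : Type) [Group G] (C : Subgroup G) : Prop :=
  ∃ (Gi : Bool → Type) (_ : ∀ i, Group (Gi i)) (K : Type) (_ : Group K)
    (φ : ∀ i, K →* Gi i),
    (∀ i, Function.Injective (φ i)) ∧ (∀ i, ¬ Function.Surjective (φ i)) ∧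
    ∃ e : G ≃* Monoid.PushoutI φ,
      C = Subgroup.comap e.toMonoidHom (Monoid.PushoutI.base φ).range

/-- `G` is an HNN-extension over the given subgroup `C`. -/
def SplitsOverHNN (G : Type) [Group G] (C : Subgroup G) : Prop :=
  ∃ (H : Type) (_ : Group H) (A B : Subgroup H) (φ : A ≃* B)
    (e : G ≃* HNNExtension H A B φ),
    C = Subgroup.comap e.toMonoidHom
      (Subgroup.map (HNNExtension.of : H →* HNNExtension H A B φ) A)

/-- `G` splits over `C`: amalgamated product with `C` proper in both factors,
or HNN-extension over `C`. -/
def SplitsOver (G : Type) [Group G] (C : Subgroup G) : Prop :=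
  SplitsOverAmalgam G C ∨ SplitsOverHNN G C

/-- Amenability of a (discrete) group: existence of a left-invariant, finitely
additive probability measure defined on all subsets. -/
def IsAmenable (G : Type) [Group G] : Prop :=
  ∃ m : Set G → ℝ, (∀ A : Set G, 0 ≤ m A) ∧ m Set.univ = 1 ∧
    (∀ A B : Set G, Disjoint A B → m (A ∪ B) = m A + m B) ∧
    (∀ (g : G) (A : Set G), m ((g * ·) '' A) = m A)


/-- The coboundary of `Y` in direction `s` meets only finitely many right cosets of `C`. -/
def FiniteCoboundary {G : Type*} [Group G] (C : Subgroup G) (Y : Set G) (s : G) : Prop :=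
  ∃ F : Set G, F.Finite ∧ ∀ g, ¬(g ∈ Y ↔ g * s ∈ Y) → ∃ f ∈ F, ∃ c ∈ C, g = c * f

/-- A subset `Y` of a group which is left `C`-invariant, has finite coboundary modulo `C`, is mapped
strictly into itself by `h`, and together with its inverse and one translate covers the group. -/
structure IsSplittingHalf {G : Type*} [Group G] (C : Subgroup G) (Y : Set G) (h x : G) : Prop where
  smul_mem : ∀ c ∈ C, ∀ y ∈ Y, c * y ∈ Y
  coboundary : ∀ s, FiniteCoboundary C Y s
  translate_mem : ∀ y ∈ Y, h * y ∈ Y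
  strict : ∃ z ∈ Y, h⁻¹ * z ∉ Y
  cover : ∀ g, g ∈ Y ∨ g⁻¹ ∈ Y ∨ x * g ∈ Y

section FiniteCoboundary

variable {G : Type*} [Group G] {C : Subgroup G} {Y : Set G}

lemma FiniteCoboundary.mul {s t : G} (hs : FiniteCoboundary C Y s)
    (ht : FiniteCoboundary C Y t) : FiniteCoboundary C Y (s * t) := by
  obtain ⟨F, hF, hs⟩ := hs
  obtain ⟨E, hE, ht⟩ := ht
  refine ⟨F ∪ (· * s⁻¹) '' E, hF.union (hE.image _), fun g hg => ?_⟩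
  by_cases h : g ∈ Y ↔ g * s ∈ Y
  · have h2 : ¬(g * s ∈ Y ↔ g * s * t ∈ Y) := by
      rw [← h, mul_assoc]; exact hg
    obtain ⟨f, hf, c, hc, e⟩ := ht _ h2
    exact ⟨f * s⁻¹, Or.inr ⟨f, hf, rfl⟩, c, hc, by rw [← mul_assoc, ← e]; group⟩
  · obtain ⟨f, hf, c, hc, e⟩ := hs _ h
    exact ⟨f, Or.inl hf, c, hc, e⟩

lemma FiniteCoboundary.inv {s : G} (hs : FiniteCoboundary C Y s) : FiniteCoboundary C Y s⁻¹ := by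
  obtain ⟨F, hF, hs⟩ := hs
  refine ⟨(· * s) '' F, hF.image _, fun g hg => ?_⟩
  obtain ⟨f, hf, c, hc, e⟩ := hs (g * s⁻¹) (by simpa [iff_comm] using hg)
  exact ⟨f * s, ⟨f, hf, rfl⟩, c, hc, by rw [← mul_assoc, ← e]; group⟩

lemma FiniteCoboundary.compl {s : G} (hs : FiniteCoboundary C Y s) : FiniteCoboundary C Yᶜ s := by
  obtain ⟨F, hF, hs⟩ := hs
  exact ⟨F, hF, fun g hg => hs g (by simpa [not_iff_not] using hg)⟩

end FiniteCoboundary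

lemma IsSplittingHalf.comap {G G' : Type*} [Group G] [Group G'] (e : G ≃* G') {C : Subgroup G'}
    {Y : Set G'} {h x : G'} (H : IsSplittingHalf C Y h x) :
    IsSplittingHalf (C.comap e.toMonoidHom) (e ⁻¹' Y) (e.symm h) (e.symm x) where
  smul_mem c hc y hy := by simpa using H.smul_mem _ hc _ hy
  coboundary s := by
    obtain ⟨F, hF, h⟩ := H.coboundary (e s)
    refine ⟨e.symm '' F, hF.image _, fun g hg => ?_⟩
    obtain ⟨f, hf, c, hc, e'⟩ := h (e g) (by simpa using hg)
    refine ⟨_, ⟨f, hf, rfl⟩, e.symm c, by simpa using hc, ?_⟩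
    rw [← map_mul, ← e']; simp
  translate_mem y hy := by simpa using H.translate_mem _ hy
  strict := by
    obtain ⟨z, hz, h⟩ := H.strict
    exact ⟨e.symm z, by simpa using hz, by simpa using h⟩
  cover g := by simpa using H.cover (e g)

section Amalgam

open Monoid

variable {ι : Type*} {Gi : ι → Type*} [∀ i, Group (Gi i)] {K : Type*} [Group K]
  {φ : ∀ i, K →* Gi i}

/-- Elements of an amalgamated product whose normal form starts with a letter of the factor `i`. -/
def startsIn (d : PushoutI.NormalWord.Transversal φ) (i : ι) : Set (PushoutI φ) :=
  {g | ∃ w : PushoutI.NormalWord d, w.prod = g ∧ w.fstIdx = some i}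

variable {d : PushoutI.NormalWord.Transversal φ}

lemma startsIn_unique {i j : ι} {g : PushoutI φ} (hi : g ∈ startsIn d i) (hj : g ∈ startsIn d j) :
    i = j := by
  classical
  obtain ⟨w, rfl, hw⟩ := hi
  obtain ⟨w', h, hw'⟩ := hj
  obtain rfl := PushoutI.NormalWord.prod_injective h
  simpa [hw] using hw'

lemma base_mul_mem_startsIn {i : ι} {g : PushoutI φ} (k : K) (hg : g ∈ startsIn d i) :
    PushoutI.base φ k * g ∈ startsIn d i := by
  obtain ⟨w, rfl, hw⟩ := hg
  exact ⟨k • w, by simp, hw⟩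

lemma base_notMem_startsIn (i : ι) (k : K) : PushoutI.base φ k ∉ startsIn d i := by
  classical
  rintro ⟨w, h, hw⟩
  have : w = k • PushoutI.NormalWord.empty := PushoutI.NormalWord.prod_injective (by simp [h])
  subst this
  simp [PushoutI.NormalWord.base_smul_def', CoprodI.Word.fstIdx] at hw

lemma one_notMem_startsIn (i : ι) : 1 ∉ startsIn d i := by
  simpa using base_notMem_startsIn (d := d) i 1

lemma of_mul_mem_startsIn {i : ι} {g : PushoutI φ} {x : Gi i} (hx : x ∉ (φ i).range)
    (hg : g ∉ startsIn d i) : PushoutI.of i x * g ∈ startsIn d i := by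
  classical
  set w := PushoutI.NormalWord.equiv (d := d) g
  have hw : w.prod = g := PushoutI.NormalWord.equiv.symm_apply_apply g
  have hi : w.fstIdx ≠ some i := fun h => hg ⟨w, hw, h⟩
  exact ⟨PushoutI.NormalWord.cons x w hi hx, by simp [hw],
    by simp [PushoutI.NormalWord.cons, CoprodI.Word.fstIdx, CoprodI.Word.cons]⟩

lemma startsIn_induction (d : PushoutI.NormalWord.Transversal φ) {p : PushoutI φ → Prop}
    (base : ∀ k, p (PushoutI.base φ k))
    (of_mul : ∀ i (x : Gi i) g, x ∉ (φ i).range → g ∉ startsIn d i → p g →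
      p (PushoutI.of i x * g)) (g : PushoutI φ) : p g := by
  classical
  obtain ⟨w, rfl⟩ : ∃ w : PushoutI.NormalWord d, w.prod = g :=
    ⟨_, PushoutI.NormalWord.equiv.symm_apply_apply g⟩
  have key : ∀ k, p (PushoutI.base φ k * w.prod) := by
    induction w using PushoutI.NormalWord.consRecOn with
    | empty => simpa using base
    | cons i g w hw hg hr _ ih =>
      intro k
      rw [PushoutI.NormalWord.prod_cons, ← mul_assoc, ← PushoutI.of_apply_eq_base φ i, ← map_mul]
      refine of_mul _ _ _ ?_ ?_ (by simpa using ih 1)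
      · rwa [Subgroup.mul_mem_cancel_left _ (MonoidHom.mem_range.2 ⟨k, rfl⟩)]
      · rintro ⟨w', h, hw'⟩
        obtain rfl := PushoutI.NormalWord.prod_injective h
        exact hw hw'
    | base k w h ih =>
      intro k'
      rw [PushoutI.NormalWord.prod_smul, ← mul_assoc, ← map_mul]
      exact ih _
  simpa using key 1

lemma mem_base_or_startsIn (d : PushoutI.NormalWord.Transversal φ) (g : PushoutI φ) :
    g ∈ (PushoutI.base φ).range ∨ ∃ i, g ∈ startsIn d i :=
  startsIn_induction d (p := fun g => g ∈ (PushoutI.base φ).range ∨ ∃ i, g ∈ startsIn d i)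
    (fun k => Or.inl ⟨k, rfl⟩) (fun i _ _ hx hg _ => Or.inr ⟨i, of_mul_mem_startsIn hx hg⟩) g

lemma mul_of_mem_startsIn (g : PushoutI φ) {i j : ι} (hg : g ∈ startsIn d i) (b : Gi j) :
    g * PushoutI.of j b ∈ startsIn d i ∨ g * PushoutI.of j b ∈ (PushoutI.base φ).range ∧ i = j := by
  induction g using startsIn_induction d generalizing i with
  | base k => exact absurd hg (base_notMem_startsIn _ _)
  | of_mul i' x g hx hg' ih =>
    obtain rfl := startsIn_unique hg (of_mul_mem_startsIn hx hg')
    have key : ∀ k, PushoutI.of i x * PushoutI.base φ k ∈ startsIn d i := fun k =>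
      of_mul_mem_startsIn hx (base_notMem_startsIn _ _)
    rcases mem_base_or_startsIn d g with ⟨k, rfl⟩ | ⟨i', hi'⟩
    · by_cases hij : i = j
      · subst hij
        rw [← PushoutI.of_apply_eq_base φ i, ← map_mul, ← map_mul]
        by_cases hr : x * φ i k * b ∈ (φ i).range
        · obtain ⟨k', hk'⟩ := hr
          exact Or.inr ⟨⟨k', by rw [← PushoutI.of_apply_eq_base φ i, hk']⟩, rfl⟩
        · left
          simpa using of_mul_mem_startsIn hr (one_notMem_startsIn i)
      · left
        rw [mul_assoc, ← PushoutI.of_apply_eq_base φ j, ← map_mul]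
        by_cases hr : φ j k * b ∈ (φ j).range
        · obtain ⟨k', hk'⟩ := hr
          rw [← hk', PushoutI.of_apply_eq_base]
          exact key _
        · refine of_mul_mem_startsIn hx fun h => hij (startsIn_unique h ?_)
          simpa using of_mul_mem_startsIn hr (one_notMem_startsIn j)
    · left
      rw [mul_assoc]
      rcases ih hi' with h | ⟨⟨k, h⟩, -⟩
      · refine of_mul_mem_startsIn hx fun h' => hg' ?_
        rwa [startsIn_unique h' h]
      · rw [← h]; exact key k

lemma finiteCoboundary_startsIn (i : ι) (s : PushoutI φ) :
    FiniteCoboundary (PushoutI.base φ).range (startsIn d i) s := by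
  have hof : ∀ j (b : Gi j), FiniteCoboundary (PushoutI.base φ).range (startsIn d i)
      (PushoutI.of j b) := by
    intro j b
    refine ⟨{1, (PushoutI.of j b)⁻¹}, by simp, fun g hg => ?_⟩
    by_cases h : g ∈ startsIn d i
    · rcases mul_of_mem_startsIn g h b with h' | h'
      · exact absurd (iff_of_true h h') hg
      · exact ⟨(PushoutI.of j b)⁻¹, by simp, _, h'.1, by group⟩
    · have h' : g * PushoutI.of j b ∈ startsIn d i := by tauto
      rcases mul_of_mem_startsIn _ h' b⁻¹ with h' | h'
      · simp [h] at h'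
      · exact ⟨1, by simp, _, h'.1, by simp⟩
  induction s using PushoutI.induction_on with
  | of i x => exact hof i x
  | base k => rw [← PushoutI.of_apply_eq_base φ i]; exact hof _ _
  | mul x y hx hy => exact hx.mul hy

lemma exists_isSplittingHalf_amalgam (hφ : ∀ i, Function.Injective (φ i)) {i j : ι} (hij : i ≠ j)
    (hi : ¬ Function.Surjective (φ i)) (hj : ¬ Function.Surjective (φ j)) :
    ∃ Y h x, IsSplittingHalf (PushoutI.base φ).range Y h x := by
  obtain ⟨d⟩ := PushoutI.NormalWord.transversal_nonempty φ hφ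
  obtain ⟨a, ha⟩ := not_forall.1 hi
  obtain ⟨b, hb⟩ := not_forall.1 hj
  refine ⟨startsIn d i, PushoutI.of i a * PushoutI.of j b, PushoutI.of i a, ?_,
    finiteCoboundary_startsIn i, ?_, ⟨PushoutI.of i a, ?_, ?_⟩, fun g => ?_⟩
  · rintro _ ⟨k, rfl⟩ y hy
    exact base_mul_mem_startsIn k hy
  · intro y hy
    rw [mul_assoc]
    exact of_mul_mem_startsIn ha fun h => hij (startsIn_unique h
      (of_mul_mem_startsIn hb fun h => hij (startsIn_unique hy h)))
  · simpa using of_mul_mem_startsIn ha (one_notMem_startsIn i)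
  · have hb' : b⁻¹ ∉ (φ j).range := by rwa [inv_mem_iff]
    have := of_mul_mem_startsIn (d := d) hb' (one_notMem_startsIn j)
    intro h
    refine hij (startsIn_unique h ?_)
    simpa using this
  · by_cases h : g ∈ startsIn d i
    · exact Or.inl h
    · exact Or.inr (Or.inr (of_mul_mem_startsIn ha h))

end Amalgam

section HNN

open HNNExtension HNNExtension.NormalWord

variable {H : Type*} [Group H] {A B : Subgroup H} (φ : A ≃* B)

/-- Elements of an HNN extension whose reduced words start with `a * t⁻¹` for some `a ∈ A`. -/
def startsInv : Set (HNNExtension H A B φ) :=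
  {g | ∃ w : ReducedWord H A B, w.prod φ = g ∧ w.head ∈ A ∧
    w.toList.head?.map Prod.fst = some (-1)}

variable {φ}

lemma exists_reducedWord (g : HNNExtension H A B φ) : ∃ w : ReducedWord H A B, w.prod φ = g := by
  classical
  obtain ⟨d⟩ := TransversalPair.nonempty H A B
  exact ⟨(NormalWord.equiv φ d g).toReducedWord, (NormalWord.equiv φ d).symm_apply_apply g⟩

lemma prod_mem_startsInv {w : ReducedWord H A B} :
    w.prod φ ∈ startsInv φ ↔ w.head ∈ A ∧ w.toList.head?.map Prod.fst = some (-1) := by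
  refine ⟨?_, fun h => ⟨w, rfl, h⟩⟩
  rintro ⟨w', h, hA, hl⟩
  obtain ⟨h1, h2⟩ := ReducedWord.map_fst_eq_and_of_prod_eq φ h
  have h3 : w'.head⁻¹ * w.head ∈ A := by simpa using h2 (-1) hl
  refine ⟨(Subgroup.mul_mem_cancel_left _ (A.inv_mem hA)).1 h3, ?_⟩
  rw [← List.head?_map, ← h1, List.head?_map, hl]

lemma of_mul_prod (x : H) (w : ReducedWord H A B) :
    of x * w.prod φ = ReducedWord.prod φ ⟨x * w.head, w.toList, w.chain⟩ := by
  simp [ReducedWord.prod, mul_assoc]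

lemma of_mul_mem_startsInv {x : H} {g : HNNExtension H A B φ} (hg : g ∈ startsInv φ) :
    of x * g ∈ startsInv φ ↔ x ∈ A := by
  obtain ⟨w, rfl⟩ := exists_reducedWord g
  have h := prod_mem_startsInv.1 hg
  rw [of_mul_prod, prod_mem_startsInv]
  simp [h.2, A.mul_mem_cancel_right h.1]

lemma t_mul_notMem_startsInv {g : HNNExtension H A B φ} (hg : g ∉ startsInv φ) :
    t * g ∉ startsInv φ := by
  obtain ⟨w, rfl⟩ := exists_reducedWord g
  rw [prod_mem_startsInv] at hg
  have hc : ((1, w.head) :: w.toList).IsChain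
      (fun a b => a.2 ∈ toSubgroup A B a.1 → a.1 = b.1) := by
    refine List.isChain_cons.2 ⟨fun y hy hA => ?_, w.chain⟩
    rcases Int.units_eq_one_or y.1 with h | h
    · exact h.symm
    · refine absurd ⟨hA, ?_⟩ hg
      rw [Option.mem_def.1 hy]; simp [h]
  have : t * w.prod φ = ReducedWord.prod φ ⟨1, _, hc⟩ := by simp [ReducedWord.prod, mul_assoc]
  rw [this, prod_mem_startsInv]
  simp

lemma inv_t_mem_startsInv : t⁻¹ ∈ startsInv φ :=
  ⟨⟨1, [(-1, 1)], List.isChain_singleton _⟩, by simp [ReducedWord.prod], by simp⟩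

lemma one_notMem_startsInv : 1 ∉ startsInv φ := by
  have : (1 : HNNExtension H A B φ) = (ReducedWord.empty H A B).prod φ := by
    simp [ReducedWord.prod]
  rw [this, prod_mem_startsInv]
  simp

lemma mul_of_mem_startsInv {g : HNNExtension H A B φ} (hg : g ∈ startsInv φ) (x : H) :
    g * of x ∈ startsInv φ := by
  obtain ⟨⟨a, l, hl⟩, rfl, ha, hh⟩ := hg
  rcases List.eq_nil_or_concat' l with rfl | ⟨l, ⟨u, k⟩, rfl⟩
  · simp at hh
  · rw [List.isChain_append] at hl
    refine ⟨⟨a, l ++ [(u, k * x)], ?_⟩, by simp [ReducedWord.prod, mul_assoc], ha, ?_⟩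
    · rw [List.isChain_append]
      exact ⟨hl.1, List.isChain_singleton _, fun y hy z hz => by
        simpa using hl.2.2 y hy (u, k) (by simp) |> fun h h' => by simp at hz; simp [← hz, h h']⟩
    · cases l <;> simpa using hh

lemma t_zpow_mul_of (u : ℤˣ) (k : toSubgroup A B u) :
    (t : HNNExtension H A B φ) ^ (u : ℤ) * of (k : H) =
      of (toSubgroupEquiv φ u k : H) * t ^ (u : ℤ) := by
  rcases Int.units_eq_one_or u with rfl | rfl
  · simp only [Units.val_one, zpow_one]
    exact t_mul_of k
  · simp only [Units.val_neg, Units.val_one, zpow_neg, zpow_one]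
    exact inv_t_mul_of k

lemma mul_t_zpow_mem_startsInv {g : HNNExtension H A B φ} (hg : g ∈ startsInv φ) (v : ℤˣ) :
    g * t ^ (v : ℤ) ∈ startsInv φ ∨ ∃ a ∈ A, g = of a * t⁻¹ := by
  obtain ⟨⟨a, l, hl⟩, rfl, ha, hh⟩ := hg
  rcases List.eq_nil_or_concat' l with rfl | ⟨l, ⟨u, k⟩, rfl⟩
  · simp at hh
  by_cases huv : k ∈ toSubgroup A B u → u = v
  · left
    refine ⟨⟨a, (l ++ [(u, k)]) ++ [(v, 1)], ?_⟩, by simp [ReducedWord.prod, mul_assoc], ha, ?_⟩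
    · rw [List.isChain_append]
      refine ⟨hl, List.isChain_singleton _, fun y hy z hz => ?_⟩
      simp only [List.getLast?_append, List.head?_cons, Option.mem_def, Option.some.injEq] at hy hz
      simp at hy
      subst hy hz
      exact huv
    · cases l <;> simpa using hh
  · push Not at huv
    obtain ⟨hk, huv⟩ := huv
    obtain rfl : v = -u := by
      rcases Int.units_eq_one_or u with rfl | rfl <;> rcases Int.units_eq_one_or v with rfl | rfl <;>
        simp_all
    have hk' := t_zpow_mul_of (φ := φ) u ⟨k, hk⟩
    rcases List.eq_nil_or_concat' l with rfl | ⟨l, ⟨u', k'⟩, rfl⟩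
    · right
      obtain rfl : u = -1 := by simpa using hh
      refine ⟨a * φ.symm ⟨k, hk⟩, A.mul_mem ha (φ.symm ⟨k, hk⟩).2, ?_⟩
      have := inv_t_mul_of (φ := φ) ⟨k, hk⟩
      simp only at this
      simp [ReducedWord.prod, mul_assoc, this]
    · left
      have hl := List.isChain_append.1 (List.isChain_append.1 hl).1
      refine ⟨⟨a, l ++ [(u', k' * toSubgroupEquiv φ u ⟨k, hk⟩)], ?_⟩, ?_, ha, ?_⟩
      · rw [List.isChain_append]
        refine ⟨hl.1, List.isChain_singleton _, fun y hy z hz => ?_⟩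
        have := hl.2.2 y hy (u', k') (by simp)
        simp at hz
        subst hz
        exact this
      · simp only at hk'
        simp [ReducedWord.prod, mul_assoc]
        rw [← mul_assoc (t ^ _) (of k), hk']
        simp
      · cases l <;> simpa using hh

lemma finiteCoboundary_startsInv (s : HNNExtension H A B φ) :
    FiniteCoboundary (A.map of) (startsInv φ) s := by
  induction s using HNNExtension.induction_on with
  | of x =>
    refine ⟨∅, Set.finite_empty, fun g hg => absurd ⟨fun h => mul_of_mem_startsInv h x, fun h => ?_⟩ hg⟩
    simpa [mul_assoc, ← map_mul] using mul_of_mem_startsInv h x⁻¹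
  | t =>
    refine ⟨{t⁻¹, t⁻¹ * t⁻¹}, by simp, fun g hg => ?_⟩
    by_cases h : g ∈ startsInv φ
    · rcases mul_t_zpow_mem_startsInv h 1 with h' | ⟨a, ha, h'⟩
      · exact absurd (iff_of_true h (by simpa using h')) hg
      · exact ⟨t⁻¹, by simp, of a, ⟨a, ha, rfl⟩, h'⟩
    · have h1 : g * t ∈ startsInv φ := by tauto
      rcases mul_t_zpow_mem_startsInv h1 (-1) with h' | ⟨a, ha, h'⟩
      · simp [h] at h'
      · exact ⟨t⁻¹ * t⁻¹, by simp, of a, ⟨a, ha, rfl⟩, by rw [← mul_assoc, ← h']; group⟩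
  | mul x y hx hy => exact hx.mul hy
  | inv x hx => exact hx.inv

lemma isSplittingHalf_compl_startsInv {x : H} (hx : x ∉ A) :
    IsSplittingHalf (A.map of) (startsInv φ)ᶜ t (of x) where
  smul_mem := by
    rintro _ ⟨a, ha, rfl⟩ y hy h
    exact hy (by simpa using (of_mul_mem_startsInv h (x := a⁻¹)).2 (A.inv_mem ha))
  coboundary s := (finiteCoboundary_startsInv s).compl
  translate_mem _ hy := t_mul_notMem_startsInv hy
  strict := ⟨1, one_notMem_startsInv, by simpa using inv_t_mem_startsInv⟩
  cover g := by
    by_cases h : g ∈ startsInv φ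
    · exact Or.inr (Or.inr fun h' => hx ((of_mul_mem_startsInv h).1 h'))
    · exact Or.inl h

variable (φ) in
/-- The homomorphism from an HNN extension to `ℤ` counting the stable letter. -/
def height : HNNExtension H A B φ →* Multiplicative ℤ :=
  HNNExtension.lift 1 (Multiplicative.ofAdd 1) (by simp)

/-- Elements of the form `x * t ^ n` with `x` in the base group and `n` a natural number. -/
def nonnegPart (φ : A ≃* B) : Set (HNNExtension H A B φ) :=
  {g | ∃ (x : H) (n : ℕ), g = of x * t ^ n}

lemma height_of_mem_nonnegPart {g : HNNExtension H A B φ} (hg : g ∈ nonnegPart φ) :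
    0 ≤ Multiplicative.toAdd (height φ g) := by
  obtain ⟨x, n, rfl⟩ := hg
  simp [height]

lemma height_t : height φ t = Multiplicative.ofAdd 1 := by simp [height]

lemma t_pow_mul_of (hA : A = ⊤) (n : ℕ) (x : H) :
    ∃ y, (t : HNNExtension H A B φ) ^ n * of x = of y * t ^ n := by
  induction n generalizing x with
  | zero => exact ⟨x, by simp⟩
  | succ n ih =>
    have hx : x ∈ A := hA ▸ Subgroup.mem_top x
    obtain ⟨y, hy⟩ := ih (φ ⟨x, hx⟩)
    exact ⟨y, by rw [pow_succ, mul_assoc, t_mul_of ⟨x, hx⟩, ← mul_assoc, hy, mul_assoc]⟩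

lemma mul_of_mem_nonnegPart (hA : A = ⊤) {g : HNNExtension H A B φ} (hg : g ∈ nonnegPart φ)
    (x : H) : g * of x ∈ nonnegPart φ := by
  obtain ⟨y, n, rfl⟩ := hg
  obtain ⟨z, hz⟩ := t_pow_mul_of (φ := φ) hA n x
  exact ⟨y * z, n, by simp [mul_assoc, hz]⟩

lemma finiteCoboundary_nonnegPart (hA : A = ⊤) (s : HNNExtension H A B φ) :
    FiniteCoboundary (A.map of) (nonnegPart φ) s := by
  induction s using HNNExtension.induction_on with
  | of x =>
    refine ⟨∅, Set.finite_empty,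
      fun g hg => absurd ⟨fun h => mul_of_mem_nonnegPart hA h x, fun h => ?_⟩ hg⟩
    simpa [mul_assoc, ← map_mul] using mul_of_mem_nonnegPart hA h x⁻¹
  | t =>
    refine ⟨{t⁻¹}, by simp, fun g hg => ?_⟩
    by_cases h : g ∈ nonnegPart φ
    · refine absurd (iff_of_true h ?_) hg
      obtain ⟨x, n, rfl⟩ := h
      exact ⟨x, n + 1, by simp [pow_succ, mul_assoc]⟩
    · obtain ⟨x, n, h1⟩ : g * t ∈ nonnegPart φ := by tauto
      cases n with
      | zero => exact ⟨t⁻¹, by simp, of x, ⟨x, by simp [hA], rfl⟩, by rw [eq_mul_inv_iff_mul_eq, h1]; simp⟩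
      | succ n => exact absurd ⟨x, n, by simpa [pow_succ, ← mul_assoc] using h1⟩ h
  | mul x y hx hy => exact hx.mul hy
  | inv x hx => exact hx.inv

lemma isSplittingHalf_compl_nonnegPart (hA : A = ⊤) :
    IsSplittingHalf (A.map of) (nonnegPart φ)ᶜ t⁻¹ t⁻¹ where
  smul_mem := by
    rintro _ ⟨a, -, rfl⟩ y hy ⟨x, n, h⟩
    exact hy ⟨a⁻¹ * x, n, by simp [mul_assoc, ← h]⟩
  coboundary s := (finiteCoboundary_nonnegPart hA s).compl
  translate_mem := by
    rintro y hy ⟨x, n, h⟩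
    obtain ⟨z, hz⟩ := t_pow_mul_of (φ := φ) hA 1 x
    refine hy ⟨z, n + 1, ?_⟩
    rw [inv_mul_eq_iff_eq_mul] at h
    simp only [pow_one] at hz
    rw [h, ← mul_assoc, hz, mul_assoc, pow_succ']
  strict := by
    refine ⟨t⁻¹, fun h => ?_, fun h => h ⟨1, 0, by simp⟩⟩
    have := height_of_mem_nonnegPart h
    simp [height_t] at this
  cover g := by
    by_contra! h
    simp only [Set.mem_compl_iff, not_not] at h
    have h1 := height_of_mem_nonnegPart h.1
    have h2 := height_of_mem_nonnegPart h.2.1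
    have h3 := height_of_mem_nonnegPart h.2.2
    simp [height_t] at h2 h3
    omega

lemma exists_isSplittingHalf_hnn (φ : A ≃* B) :
    ∃ Y h x, IsSplittingHalf (A.map (of : H →* HNNExtension H A B φ)) Y h x := by
  by_cases hA : A = ⊤
  · exact ⟨_, _, _, isSplittingHalf_compl_nonnegPart hA⟩
  · obtain ⟨x, hx⟩ : ∃ x, x ∉ A := by
      by_contra! h
      exact hA ((Subgroup.eq_top_iff' A).2 h)
    exact ⟨_, _, _, isSplittingHalf_compl_startsInv hx⟩

end HNN

lemma exists_isSplittingHalf {G : Type} [Group G] {C : Subgroup G} (h : SplitsOver G C) :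
    ∃ Y h x, IsSplittingHalf C Y h x := by
  rcases h with ⟨Gi, _, K, _, φ, hφ, hs, e, rfl⟩ | ⟨H, _, A, B, φ, e, rfl⟩
  · obtain ⟨Y, h, x, hY⟩ := exists_isSplittingHalf_amalgam hφ Bool.false_ne_true (hs _) (hs _)
    exact ⟨_, _, _, hY.comap e⟩
  · obtain ⟨Y, h, x, hY⟩ := exists_isSplittingHalf_hnn φ
    exact ⟨_, _, _, hY.comap e⟩

section WordBall

variable {G : Type} [Group G]

lemma one_mem_wordBall (T : Set G) (n : ℕ) : 1 ∈ wordBall T n :=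
  ⟨[], by simp, by simp, rfl⟩

lemma wordBall_mono (T : Set G) {m n : ℕ} (h : m ≤ n) : wordBall T m ⊆ wordBall T n :=
  fun _ ⟨l, h1, h2, h3⟩ => ⟨l, h1, h2.trans h, h3⟩

lemma mul_mem_wordBall_succ {T : Set G} {n : ℕ} {s g : G} (hs : s ∈ T ∨ s⁻¹ ∈ T)
    (hg : g ∈ wordBall T n) : s * g ∈ wordBall T (n + 1) := by
  obtain ⟨l, h1, h2, rfl⟩ := hg
  refine ⟨s :: l, ?_, by simpa using h2, by simp⟩
  simpa [hs] using h1

lemma wordBall_finite {T : Set G} (hT : T.Finite) (n : ℕ) : (wordBall T n).Finite := by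
  induction n with
  | zero =>
    refine (Set.finite_singleton 1).subset ?_
    rintro _ ⟨l, -, h2, rfl⟩
    simp [List.eq_nil_of_length_eq_zero (Nat.le_zero.1 h2)]
  | succ n ih =>
    refine ((Set.finite_singleton 1).union (((hT.union hT.inv)).image2 (· * ·) ih)).subset ?_
    rintro _ ⟨l, h1, h2, rfl⟩
    cases l with
    | nil => exact Or.inl rfl
    | cons s l =>
      refine Or.inr ⟨s, by simpa using h1 s, l.prod, ⟨l, fun x hx => h1 x (by simp [hx]), ?_, rfl⟩, ?_⟩
      · simpa using h2
      · simp

lemma exists_mem_wordBall {T : Set G} {g : G} (hg : g ∈ Subgroup.closure T) :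
    ∃ n, g ∈ wordBall T n := by
  rw [← Subgroup.mem_toSubmonoid, Subgroup.closure_toSubmonoid] at hg
  obtain ⟨l, hl, rfl⟩ := Submonoid.exists_list_of_mem_closure hg
  exact ⟨l.length, l, by simpa using hl, le_rfl, rfl⟩

lemma mem_wordBall_of_wordDist_le {T : Set G} {g : G} (hg : g ∈ Subgroup.closure T) {n : ℕ}
    (h : wordDist T 1 g ≤ n) : g ∈ wordBall T n := by
  have : {n | (1 : G)⁻¹ * g ∈ wordBall T n}.Nonempty := by
    obtain ⟨n, hn⟩ := exists_mem_wordBall hg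
    exact ⟨n, by simpa using hn⟩
  have h' := Nat.sInf_mem this
  simp only [inv_one, one_mul, Set.mem_ofPred_eq] at h'
  refine wordBall_mono T h ?_
  simpa [wordDist] using h'

end WordBall

section Cayley

variable {G : Type} [Group G] {S : Set G}

lemma cayley_adj {a b : G} :
    (cayley G S).Adj a b ↔ a ≠ b ∧ (a⁻¹ * b ∈ S ∨ (a⁻¹ * b)⁻¹ ∈ S) := by
  simp [cayley, SimpleGraph.fromRel_adj]

lemma cayley_adj_mul_left (g : G) {a b : G} :
    (cayley G S).Adj (g * a) (g * b) ↔ (cayley G S).Adj a b := by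
  simp [cayley_adj, mul_assoc]

lemma cayley_connected (hS : Subgroup.closure S = ⊤) : (cayley G S).Connected := by
  have key : ∀ g a : G, (cayley G S).Reachable a (a * g) := by
    intro g
    have hg : g ∈ Subgroup.closure S := hS ▸ Subgroup.mem_top g
    induction hg using Subgroup.closure_induction with
    | mem s hs =>
      intro a
      by_cases h : a = a * s
      · rw [← h]
      · exact SimpleGraph.Adj.reachable (cayley_adj.2 ⟨h, by simp [hs]⟩)
    | one => simp
    | mul x y _ _ hx hy => intro a; rw [← mul_assoc]; exact (hx a).trans (hy _)
    | inv x _ hx => intro a; simpa using (hx (a * x⁻¹)).symm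
  exact { preconnected := fun a b => by simpa using key (a⁻¹ * b) a, nonempty := ⟨1⟩ }

lemma cayley_dist_mul_left_le (hS : Subgroup.closure S = ⊤) (g a b : G) :
    (cayley G S).dist (g * a) (g * b) ≤ (cayley G S).dist a b := by
  obtain ⟨p, hp⟩ := (cayley_connected hS).exists_walk_length_eq_dist a b
  let f : cayley G S →g cayley G S := ⟨(g * ·), fun h => (cayley_adj_mul_left g).2 h⟩
  rw [← hp, ← SimpleGraph.Walk.length_map f p]
  exact SimpleGraph.dist_le _

lemma cayley_dist_mul_left (hS : Subgroup.closure S = ⊤) (g a b : G) :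
    (cayley G S).dist (g * a) (g * b) = (cayley G S).dist a b := by
  refine le_antisymm (cayley_dist_mul_left_le hS g a b) ?_
  simpa using cayley_dist_mul_left_le hS g⁻¹ (g * a) (g * b)

lemma cayley_dist_eq (hS : Subgroup.closure S = ⊤) (a b : G) :
    (cayley G S).dist a b = (cayley G S).dist 1 (a⁻¹ * b) := by
  simpa using (cayley_dist_mul_left hS a⁻¹ a b).symm

lemma cayley_dist_one_mul_le (hS : Subgroup.closure S = ⊤) (a b : G) :
    (cayley G S).dist 1 (a * b) ≤ (cayley G S).dist 1 a + (cayley G S).dist 1 b := by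
  have := (cayley_connected hS).dist_triangle (u := 1) (v := a) (w := a * b)
  rwa [cayley_dist_eq hS a, inv_mul_cancel_left] at this

lemma cayley_dist_one_inv (hS : Subgroup.closure S = ⊤) (a : G) :
    (cayley G S).dist 1 a⁻¹ = (cayley G S).dist 1 a := by
  rw [SimpleGraph.dist_comm, cayley_dist_eq hS]; simp

lemma cayley_ball_finite (hS : IsFiniteGenSet S) (n : ℕ) :
    {g | (cayley G S).dist 1 g ≤ n}.Finite := by
  have key : ∀ a b (p : (cayley G S).Walk a b), a⁻¹ * b ∈ wordBall S p.length := by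
    intro a b p
    induction p with
    | nil => simpa using one_mem_wordBall S 0
    | @cons u v w h p ih =>
      have := mul_mem_wordBall_succ (s := u⁻¹ * v) (cayley_adj.1 h).2 ih
      simpa [mul_assoc] using this
  refine (wordBall_finite hS.1 n).subset fun g hg => ?_
  obtain ⟨p, hp⟩ := (cayley_connected hS.2).exists_walk_length_eq_dist 1 g
  have := key 1 g p
  rw [inv_one, one_mul, hp] at this
  exact wordBall_mono S hg this

end Cayley

section Firefighting

lemma exists_injOn_lt_ncard {V : Type*} (P : Set V) (ℓ : V → ℕ)
    (hfin : ∀ m, {v | v ∈ P ∧ ℓ v ≤ m}.Finite) :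
    ∃ idx : V → ℕ, Set.InjOn idx P ∧ ∀ v ∈ P, idx v < {w | w ∈ P ∧ ℓ w ≤ ℓ v}.ncard := by
  classical
  let _ : LinearOrder V := linearOrderOfSTO WellOrderingRel
  let f : V → ℕ ×ₗ V := fun v => toLex (ℓ v, v)
  have hf : ∀ {v w}, f v < f w → ℓ v ≤ ℓ w := fun {v w} h => by
    rcases Prod.Lex.toLex_lt_toLex.1 h with h | h
    · exact h.le
    · exact h.1.le
  have hfin' : ∀ v, {w | w ∈ P ∧ f w < f v}.Finite := fun v =>
    (hfin (ℓ v)).subset fun w hw => ⟨hw.1, hf hw.2⟩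
  have hlt : ∀ v ∈ P, ∀ w, f v < f w →
      {x | x ∈ P ∧ f x < f v}.ncard < {x | x ∈ P ∧ f x < f w}.ncard := fun v hv w h => by
    refine Set.ncard_lt_ncard ⟨fun x hx => ⟨hx.1, hx.2.trans h⟩, fun hsub => ?_⟩ (hfin' w)
    exact lt_irrefl _ (hsub (⟨hv, h⟩ : v ∈ {x | x ∈ P ∧ f x < f w})).2
  refine ⟨fun v => {w | w ∈ P ∧ f w < f v}.ncard, fun v hv w hw h => ?_, fun v hv => ?_⟩
  · by_contra hne
    have hne' : f v ≠ f w := fun h => hne (congrArg (fun x => (ofLex x).2) h)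
    rcases lt_or_gt_of_ne hne' with h' | h'
    · exact (hlt v hv w h').ne h
    · exact (hlt w hw v h').ne h.symm
  · refine Set.ncard_lt_ncard ⟨fun x hx => ⟨hx.1, hf hx.2⟩, fun hsub => ?_⟩ (hfin _)
    exact lt_irrefl _ (hsub (⟨hv, le_rfl⟩ : v ∈ {w | w ∈ P ∧ ℓ w ≤ ℓ v})).2

lemma succ_pow_le (n d : ℕ) : (n + 1) ^ d ≤ n ^ d + d * (n + 1) ^ (d - 1) := by
  induction d with
  | zero => simp
  | succ d ih =>
    cases d with
    | zero => simp
    | succ d =>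
      simp only [Nat.add_sub_cancel] at ih ⊢
      calc (n + 1) ^ (d + 1 + 1) = n * (n + 1) ^ (d + 1) + (n + 1) ^ (d + 1) := by ring
        _ ≤ n * (n ^ (d + 1) + (d + 1) * (n + 1) ^ d) + (n + 1) ^ (d + 1) := by gcongr
        _ ≤ n ^ (d + 1 + 1) + (d + 1) * ((n + 1) * (n + 1) ^ d) + (n + 1) ^ (d + 1) := by
          have : n * (n + 1) ^ d ≤ (n + 1) * (n + 1) ^ d := by gcongr; simp
          rw [show n * (n ^ (d + 1) + (d + 1) * (n + 1) ^ d)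
            = n ^ (d + 1 + 1) + (d + 1) * (n * (n + 1) ^ d) by ring]
          gcongr
        _ = _ := by ring

/-- If the inner vertex boundary of `Z` has polynomial growth of degree `d` and `Z` is far from the
initial fire, then `Z` can be saved by protecting its boundary in order of distance. -/
lemma exists_strategy_disjoint {V : Type*} (Γ : SimpleGraph V) (ℓ : V → ℕ)
    (hℓ : ∀ u v, Γ.Adj u v → ℓ v ≤ ℓ u + 1) (Z X0 : Set V) (K d R : ℕ) (hd : 0 < d)
    (hfin : ∀ m, {v | ℓ v ≤ m}.Finite)
    (hcard : ∀ m, 1 ≤ m → {v | (v ∈ Z ∧ ∃ u ∉ Z, Γ.Adj u v) ∧ ℓ v ≤ m}.ncard ≤ K * m ^ d)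
    (hX0 : ∀ v ∈ X0, ℓ v ≤ R) (hZ : ∀ v ∈ Z, 2 * R < ℓ v) :
    ∃ W : ℕ → Set V, IsStrategyBound (fun n => K * 2 ^ d * d * n ^ (d - 1)) W ∧
      Disjoint (burnedSet Γ 1 W X0) Z := by
  set P : Set V := {v | v ∈ Z ∧ ∃ u ∉ Z, Γ.Adj u v}
  obtain ⟨idx, hinj, hidx⟩ := exists_injOn_lt_ncard P ℓ
    (fun m => (hfin m).subset fun v hv => hv.2)
  let s : ℕ → ℕ := fun n => K * 2 ^ d * n ^ d
  let W : ℕ → Set V := fun n => {v | v ∈ P ∧ idx v ∈ Finset.Ico (s (n - 1)) (s n)}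
  have hprot : ∀ n, ∀ v ∈ P, idx v < s n → v ∈ protectedUpTo W n := by
    intro n v hv
    induction n with
    | zero => intro h; simp [s, hd.ne'] at h
    | succ n ih =>
      intro h
      by_cases h' : idx v < s n
      · obtain ⟨i, hi, hvi⟩ := Set.mem_iUnion₂.1 (ih h')
        refine Set.mem_iUnion₂.2 ⟨i, ?_, hvi⟩
        simp only [Finset.mem_Icc] at hi ⊢
        omega
      · exact Set.mem_iUnion₂.2 ⟨n + 1, by simp, hv, by simpa using ⟨not_lt.1 h', h⟩⟩
  have hfire : ∀ n, (∀ v ∈ fireSet Γ 1 W X0 n, v ∉ Z ∧ ℓ v ≤ R + n) := by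
    intro n
    induction n with
    | zero =>
      intro v hv
      have := hX0 v hv
      exact ⟨fun h => by have := hZ v h; omega, this⟩
    | succ n ih =>
      rintro v ⟨u, hu, p, hp, hsupp⟩
      obtain ⟨huZ, hul⟩ := ih u hu
      cases p with
      | nil => exact ⟨huZ, by omega⟩
      | cons h p =>
        cases p with
        | cons h' p => simp at hp
        | nil =>
          have hvl := hℓ _ _ h
          refine ⟨fun hvZ => ?_, by omega⟩
          have hvP : v ∈ P := ⟨hvZ, u, huZ, h⟩
          refine hsupp v (by simp) ⟨hprot _ v hvP ?_, fun hv => (ih v hv).1 hvZ⟩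
          have h2R := hZ v hvZ
          calc idx v < _ := hidx v hvP
            _ ≤ K * ℓ v ^ d := hcard _ (by omega)
            _ ≤ K * (2 * (n + 1)) ^ d := by gcongr; omega
            _ = s (n + 1) := by simp only [s, mul_pow]; ring
  refine ⟨W, fun n hn => ?_, ?_⟩
  · have hmaps : Set.MapsTo idx (W n) (Finset.Ico (s (n - 1)) (s n)) := fun v hv => hv.2
    have hinj' : Set.InjOn idx (W n) := hinj.mono fun v hv => hv.1
    refine ⟨Set.Finite.of_injOn hmaps hinj' (Finset.finite_toSet _), ?_⟩
    refine (Set.ncard_le_ncard_of_injOn idx hmaps hinj' (Finset.finite_toSet _)).trans ?_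
    rw [Set.ncard_coe_finset, Nat.card_Ico]
    obtain ⟨n, rfl⟩ := Nat.exists_eq_add_of_le' hn
    have := Nat.mul_le_mul_left (K * 2 ^ d) (succ_pow_le n d)
    simp only [s, Nat.add_sub_cancel]
    rw [Nat.sub_le_iff_le_add]
    linarith
  · rw [Set.disjoint_left]
    intro v hv
    obtain ⟨n, hn⟩ := Set.mem_iUnion.1 hv
    exact (hfire n v hn).1

end Firefighting

section Escape

variable {G : Type*} [Group G] {C : Subgroup G} {Y : Set G} {h x : G}

lemma IsSplittingHalf.pow_mul_mem (H : IsSplittingHalf C Y h x) (n : ℕ) {y : G} (hy : y ∈ Y) :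
    h ^ n * y ∈ Y := by
  induction n with
  | zero => simpa using hy
  | succ n ih => rw [pow_succ', mul_assoc]; exact H.translate_mem _ ih

/-- The translates `h ^ n Y` eventually avoid any given element. -/
lemma IsSplittingHalf.exists_forall_inv_pow_mul_notMem (H : IsSplittingHalf C Y h x) (g : G) :
    ∃ N : ℕ, ∀ n, N ≤ n → h⁻¹ ^ n * g ∉ Y := by
  obtain ⟨z, hzY, hz⟩ := H.strict
  have hz' : ∀ n, 1 ≤ n → h⁻¹ ^ n * z ∉ Y := fun n hn hmem => by
    obtain ⟨m, rfl⟩ := Nat.exists_eq_add_of_le' hn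
    refine hz ?_
    have := H.pow_mul_mem m hmem
    rwa [pow_succ, ← mul_assoc, ← mul_assoc, inv_pow h m, mul_inv_cancel, one_mul] at this
  obtain ⟨F, hF, hcob⟩ := H.coboundary (z⁻¹ * g)
  have hA : ∀ n ∈ {n | 1 ≤ n ∧ h⁻¹ ^ n * g ∈ Y}, ∃ f ∈ F, ∃ c ∈ C, h⁻¹ ^ n * z = c * f :=
    fun n hn => hcob _ fun hiff => hz' n hn.1 (hiff.2 (by simpa [mul_assoc] using hn.2))
  choose! f hfF c hc hcf using hA
  have key : ∀ m ∈ {n | 1 ≤ n ∧ h⁻¹ ^ n * g ∈ Y}, ∀ n ∈ {n | 1 ≤ n ∧ h⁻¹ ^ n * g ∈ Y},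
      f m = f n → ¬ m < n := fun m hm n hn hmn hlt => by
    obtain ⟨k, rfl⟩ := Nat.exists_eq_add_of_lt hlt
    have e := hcf _ hn
    rw [← hmn, add_assoc, add_comm m, pow_add, mul_assoc, hcf m hm, ← mul_assoc, mul_left_inj,
      ← eq_mul_inv_iff_mul_eq] at e
    refine hz' (k + 1) (by omega) (e ▸ H.smul_mem _ ?_ z hzY)
    exact C.mul_mem (add_comm m (k + 1) ▸ add_assoc m k 1 ▸ hc _ hn) (C.inv_mem (hc m hm))
  have hfin : {n | 1 ≤ n ∧ h⁻¹ ^ n * g ∈ Y}.Finite := by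
    refine Set.Finite.of_injOn (f := f) (fun n hn => hfF n hn) (fun m hm n hn hmn => ?_) hF
    exact le_antisymm (not_lt.1 (key n hn m hm hmn.symm)) (not_lt.1 (key m hm n hn hmn))
  obtain ⟨N, hN⟩ := hfin.bddAbove
  refine ⟨N + 1, fun n hn hmem => ?_⟩
  have : n ≤ N := hN ⟨by omega, hmem⟩
  omega

lemma IsSplittingHalf.exists_forall_mem_inv_pow_mul_notMem (H : IsSplittingHalf C Y h x)
    {B : Set G} (hB : B.Finite) : ∃ n : ℕ, ∀ g ∈ B, h⁻¹ ^ n * g ∉ Y := by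
  have : ∀ᶠ n : ℕ in Filter.atTop, ∀ g ∈ B, h⁻¹ ^ n * g ∉ Y :=
    (Set.Finite.eventually_all hB).2 fun g _ =>
      Filter.eventually_atTop.2 (H.exists_forall_inv_pow_mul_notMem g)
  exact this.exists

end Escape

section Counting

variable {G : Type} [Group G] {S T : Set G} {C : Subgroup G} {d : ℕ}

/-- A quasi-isometrically embedded subgroup of growth at most `n ^ d` has at most polynomially many
elements of degree `d` in the balls of the ambient group. -/
lemma exists_ncard_subgroup_ball_le (hT : T.Finite) (hTgen : Subgroup.closure T = C)
    (hgrowth : GrowthLE (fun n => (wordBall T n).ncard) (fun n => n ^ d))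
    (hqie : ∃ c : ℝ, 1 ≤ c ∧ ∀ x ∈ C, (wordDist T 1 x : ℝ) / c - c ≤ (cayley G S).dist 1 x) :
    ∃ K : ℕ, ∀ m, 1 ≤ m → {x | x ∈ C ∧ (cayley G S).dist 1 x ≤ m}.ncard ≤ K * m ^ d := by
  obtain ⟨c, hc1, hc⟩ := hqie
  obtain ⟨k, hk⟩ := exists_nat_ge c
  obtain ⟨D, -, hD⟩ := hgrowth
  refine ⟨D * (D * (2 * k * k) + D) ^ d + D, fun m hm => ?_⟩
  have hsub : {x | x ∈ C ∧ (cayley G S).dist 1 x ≤ m} ⊆ wordBall T (2 * k * k * m) := by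
    rintro x ⟨hxC, hx⟩
    refine mem_wordBall_of_wordDist_le (hTgen ▸ hxC) ?_
    have h1 := hc x hxC
    rw [sub_le_iff_le_add, div_le_iff₀ (by linarith)] at h1
    have hx' : ((cayley G S).dist 1 x : ℝ) ≤ m := by exact_mod_cast hx
    have hm' : (1 : ℝ) ≤ m := by exact_mod_cast hm
    have h2 : (wordDist T 1 x : ℝ) ≤ 2 * k * k * m := by
      calc (wordDist T 1 x : ℝ) ≤ ((cayley G S).dist 1 x + c) * c := h1
        _ ≤ (k * m + k * m) * k := by
          gcongr
          · exact hx'.trans (le_mul_of_one_le_left (by linarith) (by linarith))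
          · exact hk.trans (le_mul_of_one_le_right (by linarith) hm')
        _ = 2 * k * k * m := by ring
    exact_mod_cast h2
  calc {x | x ∈ C ∧ (cayley G S).dist 1 x ≤ m}.ncard
      ≤ (wordBall T (2 * k * k * m)).ncard := Set.ncard_le_ncard hsub (wordBall_finite hT _)
    _ ≤ D * (D * (2 * k * k * m) + D) ^ d + D := hD _
    _ ≤ D * (D * (2 * k * k * m) + D * m) ^ d + D * m ^ d := by
      gcongr
      · exact Nat.le_mul_of_pos_right _ hm
      · exact Nat.le_mul_of_pos_right _ (Nat.pow_pos hm)
    _ = D * ((D * (2 * k * k) + D) * m) ^ d + D * m ^ d := by congr 3; ring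
    _ = _ := by rw [mul_pow]; ring

/-- Translates of finitely many right cosets of `C` meet balls in polynomially many elements,
uniformly in the translating element. -/
lemma exists_ncard_cosets_ball_le (hS : IsFiniteGenSet S)
    (hC : ∃ K : ℕ, ∀ m, 1 ≤ m → {x | x ∈ C ∧ (cayley G S).dist 1 x ≤ m}.ncard ≤ K * m ^ d)
    {F : Set G} (hF : F.Finite) :
    ∃ K : ℕ, ∀ (g : G) (m : ℕ), 1 ≤ m →
      {p | (∃ f ∈ F, ∃ c ∈ C, g⁻¹ * p = c * f) ∧ (cayley G S).dist 1 p ≤ m}.ncard ≤ K * m ^ d := by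
  obtain ⟨K, hK⟩ := hC
  induction F, hF using Set.Finite.induction_on with
  | empty => exact ⟨0, by simp⟩
  | @insert f F _ _ ih =>
    obtain ⟨L, hL⟩ := ih
    set r := (cayley G S).dist 1 f with hr
    refine ⟨K * (2 + 2 * r) ^ d + L, fun g m hm => ?_⟩
    have hsingle : {p | (∃ c ∈ C, g⁻¹ * p = c * f) ∧ (cayley G S).dist 1 p ≤ m}.ncard
        ≤ K * (2 + 2 * r) ^ d * m ^ d := by
      rcases Set.eq_empty_or_nonempty
        {p | (∃ c ∈ C, g⁻¹ * p = c * f) ∧ (cayley G S).dist 1 p ≤ m} with he | ⟨q, ⟨b, hb, hq⟩, hqm⟩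
      · simp [he]
      have hmaps : Set.MapsTo (fun p => f * (q⁻¹ * p) * f⁻¹)
          {p | (∃ c ∈ C, g⁻¹ * p = c * f) ∧ (cayley G S).dist 1 p ≤ m}
          {x | x ∈ C ∧ (cayley G S).dist 1 x ≤ (2 + 2 * r) * m} := by
        rintro p ⟨⟨c, hc, hp⟩, hpm⟩
        constructor
        · have : f * (q⁻¹ * p) * f⁻¹ = b⁻¹ * c := by
            rw [inv_mul_eq_iff_eq_mul] at hp hq
            rw [hp, hq]; group
          simp only [this]
          exact C.mul_mem (C.inv_mem hb) hc
        · have h1 := cayley_dist_one_mul_le hS.2 (f * (q⁻¹ * p)) f⁻¹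
          have h2 := cayley_dist_one_mul_le hS.2 f (q⁻¹ * p)
          have h3 := cayley_dist_one_mul_le hS.2 q⁻¹ p
          rw [cayley_dist_one_inv hS.2] at h1 h3
          have : r ≤ r * m := Nat.le_mul_of_pos_right _ hm
          simp only
          nlinarith
      have hinj : Set.InjOn (fun p => f * (q⁻¹ * p) * f⁻¹)
          {p | (∃ c ∈ C, g⁻¹ * p = c * f) ∧ (cayley G S).dist 1 p ≤ m} :=
        fun p _ p' _ h => by simpa using h
      refine (Set.ncard_le_ncard_of_injOn _ hmaps hinj
        ((cayley_ball_finite hS _).subset fun x hx => hx.2)).trans ?_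
      refine (hK _ (Nat.mul_pos (by omega) hm)).trans_eq ?_
      rw [mul_pow, mul_assoc]
    have hunion : {p | (∃ f' ∈ insert f F, ∃ c ∈ C, g⁻¹ * p = c * f') ∧ (cayley G S).dist 1 p ≤ m} =
        {p | (∃ c ∈ C, g⁻¹ * p = c * f) ∧ (cayley G S).dist 1 p ≤ m} ∪
        {p | (∃ f ∈ F, ∃ c ∈ C, g⁻¹ * p = c * f) ∧ (cayley G S).dist 1 p ≤ m} := by
      ext p
      simp only [Set.exists_mem_insert, Set.mem_union, Set.mem_ofPred_eq]
      rw [or_and_right]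
    rw [hunion, add_mul]
    exact (Set.ncard_union_le _ _).trans (add_le_add hsingle (hL g m hm))

variable {Y : Set G} {h x : G}

/-- The inner vertex boundary of a translate of a splitting half is covered by the corresponding
translate of finitely many right cosets of `C`. -/
lemma IsSplittingHalf.exists_finite_boundary (H : IsSplittingHalf C Y h x) (hS : S.Finite) :
    ∃ F : Set G, F.Finite ∧ ∀ g v u : G, g⁻¹ * v ∈ Y → g⁻¹ * u ∉ Y → (cayley G S).Adj u v →
      ∃ f ∈ F, ∃ c ∈ C, g⁻¹ * v = c * f := by
  choose F hF hcob using H.coboundary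
  refine ⟨⋃ s ∈ S ∪ S⁻¹, F s, (hS.union hS.inv).biUnion fun s _ => hF s,
    fun g v u hv hu hadj => ?_⟩
  obtain ⟨f, hf, hc⟩ := hcob (v⁻¹ * u) (g⁻¹ * v) (by simp [mul_assoc, hv, hu])
  refine ⟨f, Set.mem_biUnion ?_ hf, hc⟩
  have := (cayley_adj.1 hadj).2
  simp only [mul_inv_rev, inv_inv] at this
  simpa [or_comm] using this

end Counting

section Growth

variable {G : Type} [Group G] {S : Set G} {C : Subgroup G} {Y U : Set G} {h x g : G}

lemma IsSplittingHalf.ncard_ball_le (H : IsSplittingHalf C Y h x) (hS : IsFiniteGenSet S) (n : ℕ) :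
    {v | (cayley G S).dist 1 v ≤ n}.ncard ≤
      3 * {v | v ∈ Y ∧ (cayley G S).dist 1 v ≤ n + (cayley G S).dist 1 x}.ncard := by
  set r := (cayley G S).dist 1 x
  set A : Set G := {v | v ∈ Y ∧ (cayley G S).dist 1 v ≤ n + r}
  have hA : A.Finite := (cayley_ball_finite hS (n + r)).subset fun v hv => hv.2
  have hsub : {v | (cayley G S).dist 1 v ≤ n} ⊆ (A ∪ (·⁻¹) '' A) ∪ (x⁻¹ * ·) '' A := by
    intro v hv
    rw [Set.mem_ofPred_eq] at hv
    rcases H.cover v with h1 | h1 | h1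
    · exact Or.inl (Or.inl ⟨h1, by omega⟩)
    · refine Or.inl (Or.inr ⟨v⁻¹, ⟨h1, ?_⟩, by simp⟩)
      rw [cayley_dist_one_inv hS.2]; omega
    · refine Or.inr ⟨x * v, ⟨h1, ?_⟩, by simp⟩
      have := cayley_dist_one_mul_le hS.2 x v
      omega
  have h1 := Set.ncard_le_ncard hsub ((hA.union (hA.image _)).union (hA.image _))
  have h2 := Set.ncard_union_le (A ∪ (·⁻¹) '' A) ((x⁻¹ * ·) '' A)
  have h3 := Set.ncard_union_le A ((·⁻¹) '' A)
  have h4 := Set.ncard_image_le (f := (·⁻¹)) hA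
  have h5 := Set.ncard_image_le (f := (x⁻¹ * ·)) hA
  omega

/-- A set containing a translate of a splitting half has the growth of the whole group. -/
lemma IsSplittingHalf.growthEqFull (H : IsSplittingHalf C Y h x) (hS : IsFiniteGenSet S)
    (hU : ∀ y ∈ Y, g * y ∈ U) : GrowthEqFull (cayley G S) U := by
  obtain ⟨z, hz, -⟩ := H.strict
  have hball : ∀ (a : G) n, {v | (cayley G S).dist a v ≤ n}.Finite := fun a n => by
    refine ((cayley_ball_finite hS n).image (a * ·)).subset fun v hv => ?_
    rw [Set.mem_ofPred_eq, cayley_dist_eq hS.2] at hv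
    exact ⟨a⁻¹ * v, hv, by simp⟩
  refine ⟨g * z, hU z hz, ?_, 1, one_pos, fun n => ?_⟩
  · set r := (cayley G S).dist 1 x
    set t := (cayley G S).dist 1 z
    refine ⟨3 + r + t, by omega, fun n => ?_⟩
    have h1 : graphGrowth (cayley G S) Set.univ {g * z} n
        ≤ {v | (cayley G S).dist 1 v ≤ n}.ncard := by
      refine Set.ncard_le_ncard_of_injOn ((g * z)⁻¹ * ·) (fun v hv => ?_)
        (fun _ _ _ _ h => by simpa using h) (hball 1 n)
      rw [Set.mem_ofPred_eq, ← cayley_dist_eq hS.2]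
      simpa using hv
    have h2 : {v | v ∈ Y ∧ (cayley G S).dist 1 v ≤ n + r}.ncard
        ≤ graphGrowth (cayley G S) U {g * z} (n + r + t) := by
      refine Set.ncard_le_ncard_of_injOn (g * ·) (fun v hv => ⟨hU v hv.1, g * z, rfl, ?_⟩)
        (fun _ _ _ _ h => by simpa using h)
        ((hball (g * z) (n + r + t)).subset fun v hv => by simpa using hv.2)
      rw [cayley_dist_mul_left hS.2, cayley_dist_eq hS.2]
      have := cayley_dist_one_mul_le hS.2 z⁻¹ v
      rw [cayley_dist_one_inv hS.2] at this
      have := hv.2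
      omega
    have h3 : graphGrowth (cayley G S) U {g * z} (n + r + t)
        ≤ graphGrowth (cayley G S) U {g * z} ((3 + r + t) * n + (3 + r + t)) := by
      refine Set.ncard_le_ncard (fun v ⟨hv, a, ha, hav⟩ => ⟨hv, a, ha, hav.trans ?_⟩)
        ((hball (g * z) _).subset fun v hv => by simpa using hv.2)
      nlinarith [Nat.zero_le (r * n), Nat.zero_le (t * n)]
    calc graphGrowth (cayley G S) Set.univ {g * z} n
        ≤ 3 * graphGrowth (cayley G S) U {g * z} ((3 + r + t) * n + (3 + r + t)) :=
          h1.trans ((H.ncard_ball_le hS n).trans (Nat.mul_le_mul_left 3 (h2.trans h3)))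
      _ ≤ (3 + r + t) * graphGrowth (cayley G S) U {g * z} ((3 + r + t) * n + (3 + r + t)) := by
          gcongr; omega
      _ ≤ _ := Nat.le_add_right _ _
  · have : graphGrowth (cayley G S) U {g * z} n
        ≤ graphGrowth (cayley G S) Set.univ {g * z} (1 * n + 1) :=
      Set.ncard_le_ncard (fun v ⟨_, a, ha, hav⟩ => ⟨trivial, a, ha, by omega⟩)
        ((hball (g * z) _).subset fun v hv => by simpa using hv.2)
    omega

end Growth

theorem stmt11 (G : Type) [Group G] (S : Set G) (hS : IsFiniteGenSet S)
    (C : Subgroup G) (hsplit : SplitsOver G C)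
    (T : Set G) (hTC : T ⊆ (C : Set G)) (hT : T.Finite)
    (hTgen : Subgroup.closure T = C)
    (d : ℕ) (hd : 0 < d)
    (hgrowth : GrowthEquiv (fun n => (wordBall T n).ncard) (fun n => n ^ d))
    (hqie : ∃ c : ℝ, 1 ≤ c ∧ ∀ x y : G, x ∈ C → y ∈ C →
      ((wordDist T x y : ℝ) / c - c ≤ ((cayley G S).dist x y : ℝ) ∧
       ((cayley G S).dist x y : ℝ) ≤ c * (wordDist T x y : ℝ) + c)) :
    PolyRetaining (cayley G S) (d - 1) := by
  obtain ⟨Y, h, x, H⟩ := exists_isSplittingHalf hsplit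
  obtain ⟨F, hF, hbd⟩ := H.exists_finite_boundary hS.1
  obtain ⟨K, hK⟩ := exists_ncard_cosets_ball_le hS
    (exists_ncard_subgroup_ball_le hT hTgen hgrowth.1
      (hqie.imp fun c hc => ⟨hc.1, fun y hy => (hc.2 1 y C.one_mem hy).1⟩)) hF
  refine ⟨(K + 1) * 2 ^ d * d, by positivity, fun X0 hX0 => ?_⟩
  obtain ⟨R, hR⟩ := (hX0.image ((cayley G S).dist 1)).bddAbove
  obtain ⟨n, hn⟩ := H.exists_forall_mem_inv_pow_mul_notMem (cayley_ball_finite hS (2 * R))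
  have hdist : ∀ u v, (cayley G S).Adj u v →
      (cayley G S).dist 1 v ≤ (cayley G S).dist 1 u + 1 := fun u v huv => by
    have := (cayley_connected hS.2).dist_triangle (u := 1) (v := u) (w := v)
    rwa [SimpleGraph.dist_eq_one_iff_adj.2 huv] at this
  set Z : Set G := {v | (h ^ n)⁻¹ * v ∈ Y}
  have hcard : ∀ m, 1 ≤ m → {v | (v ∈ Z ∧ ∃ u ∉ Z, (cayley G S).Adj u v) ∧
      (cayley G S).dist 1 v ≤ m}.ncard ≤ (K + 1) * m ^ d := fun m hm => by
    refine (Set.ncard_le_ncard ?_ ((cayley_ball_finite hS m).subset fun p hp => hp.2)).trans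
      ((hK (h ^ n) m hm).trans (Nat.mul_le_mul_right _ (Nat.le_succ K)))
    rintro v ⟨⟨hv, u, hu, huv⟩, hm⟩
    exact ⟨hbd _ v u hv hu huv, hm⟩
  have hfar : ∀ v ∈ Z, 2 * R < (cayley G S).dist 1 v := fun v hv => by
    by_contra hle
    refine hn v (not_lt.1 hle) ?_
    rwa [inv_pow]
  obtain ⟨W, hW, hdisj⟩ := exists_strategy_disjoint (cayley G S) ((cayley G S).dist 1) hdist Z X0
    (K + 1) d R hd (cayley_ball_finite hS) hcard (fun v hv => hR ⟨v, hv, rfl⟩) hfar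
  refine ⟨W, hW, H.growthEqFull (g := h ^ n) hS fun y hy hb => ?_⟩
  exact Set.disjoint_left.1 hdisj hb (by simpa [Z] using hy)
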